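/- (Lower semicontinuity of the action, Lemma 3.5.) The action functional 𝒜 : C([a,b];ℝⁿ) → (−∞,+∞] is sequentially lower semicontinuous with respect to the supremum metric d_Γ: whenever γ_k → γ uniformly on [a,b], one has liminf_{k→∞} 𝒜(γ_k) ≥ 𝒜(γ). -/

import Mathlib

open MeasureTheory Filter Topology
open scoped ENNReal NNReal

noncomputable section

/-- Euclidean space `ℝⁿ`. -/
abbrev Eu (n : ℕ) := EuclideanSpace ℝ (Fin n)

/-- The space `C([a,b];ℝⁿ)` of continuous curves with the supremum metric. -/
abbrev CPath (a b : ℝ) (n : ℕ) := C(Set.Icc a b, Eu n)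

/-- We endow the path space with its Borel σ-algebra. -/
noncomputable instance pathMeasurableSpace (a b : ℝ) (n : ℕ) :
    MeasurableSpace (CPath a b n) := borel _

instance pathBorelSpace (a b : ℝ) (n : ℕ) : BorelSpace (CPath a b n) :=
  ⟨rfl⟩

/-- Evaluation of a curve at time `t ∈ [a,b]` (junk value `0` outside `[a,b]`). -/
def pev {a b : ℝ} {n : ℕ} (γ : CPath a b n) (t : ℝ) : Eu n :=
  if ht : t ∈ Set.Icc a b then γ ⟨t, ht⟩ else 0

/-- A curve is absolutely continuous if it has a Bochner-integrable derivative `g` with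
`γ t = γ s + ∫_s^t g`. -/
def IsACC {a b : ℝ} {n : ℕ} (γ : CPath a b n) : Prop :=
  ∃ g : ℝ → Eu n, IntegrableOn g (Set.Icc a b) ∧
    ∀ s t : Set.Icc a b, γ t = γ s + ∫ u in (s : ℝ)..(t : ℝ), g u

open Classical in
/-- The action `𝒜(γ) = ∫_a^b L(γ(t), γ̇(t)) dt ∈ (−∞,+∞]`, equal to `+∞` on curves that are
not absolutely continuous (and, by the convention that the integral is `+∞` when the
integrand fails to be integrable -- its negative part being automatically integrable --
also on absolutely continuous curves with non-integrable Lagrangian). -/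
def action {n : ℕ} (L : Eu n → Eu n → ℝ) (a b : ℝ) (γ : CPath a b n) : EReal :=
  if h : IsACC γ then
    (if IntegrableOn (fun t => L (pev γ t) (h.choose t)) (Set.Icc a b) then
      (((∫ t in Set.Icc a b, L (pev γ t) (h.choose t)) : ℝ) : EReal)
    else ⊤)
  else ⊤

/-- Positive part of an extended real, as `ℝ≥0∞`. -/
def epos (x : EReal) : ℝ≥0∞ := if x = ⊤ then ⊤ else ENNReal.ofReal x.toReal

/-- The integral `∫ F dπ ∈ [−∞,+∞]` of an extended-real-valued function, defined as the
difference of the lower integrals of the positive and negative parts. -/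
def mint {X : Type*} [MeasurableSpace X] (F : X → EReal) (π : Measure X) : EReal :=
  ((∫⁻ γ, epos (F γ) ∂π : ℝ≥0∞) : EReal) - ((∫⁻ γ, epos (-(F γ)) ∂π : ℝ≥0∞) : EReal)

open Classical in
/-- The constrained functional `𝔸_{μa,μb}(π) = ∫ 𝒜 dπ` if `pr_a#π = μa` and `pr_b#π = μb`,
and `+∞` otherwise, for a given (extended-real-valued) action functional `F`. -/
def aFun {a b : ℝ} {n : ℕ} (F : CPath a b n → EReal) (μa μb : Measure (Eu n))
    (π : Measure (CPath a b n)) : EReal :=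
  if Measure.map (fun γ => pev γ a) π = μa ∧ Measure.map (fun γ => pev γ b) π = μb then
    mint F π
  else ⊤

/-- Weak convergence of a sequence of measures: convergence of the integrals of all bounded
continuous functions. -/
def WeakLim {X : Type*} [TopologicalSpace X] [MeasurableSpace X]
    (πs : ℕ → Measure X) (π : Measure X) : Prop :=
  ∀ φ : BoundedContinuousFunction X ℝ,
    Tendsto (fun N => ∫ x, φ x ∂(πs N)) atTop (𝓝 (∫ x, φ x ∂π))

/-- The empirical measure `(1/N) ∑_{i=1}^N δ_{x i}`. -/
def emp {X : Type*} [MeasurableSpace X] (N : ℕ) (x : Fin N → X) : Measure X :=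
  (N : ℝ≥0∞)⁻¹ • ∑ i : Fin N, Measure.dirac (x i)

/-- The topological support of a measure. -/
def msupp {α : Type*} [TopologicalSpace α] [MeasurableSpace α] (μ : Measure α) : Set α :=
  {x | ∀ U : Set α, IsOpen U → x ∈ U → 0 < μ U}

/-- The set `Γ^min_{K₁,K₂}` of minimizing extremals starting in `K₁` and ending in `K₂`. -/
def GammaMin {n : ℕ} (L : Eu n → Eu n → ℝ) (a b : ℝ) (K₁ K₂ : Set (Eu n)) :
    Set (CPath a b n) :=
  {γ | IsACC γ ∧ pev γ a ∈ K₁ ∧ pev γ b ∈ K₂ ∧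
    ∀ γ' : CPath a b n, IsACC γ' → pev γ' a = pev γ a → pev γ' b = pev γ b →
      action L a b γ ≤ action L a b γ'}

/-- The Lagrangian cost `c(x,y)`: the minimal action among absolutely continuous curves
from `x` to `y`. -/
def cost {n : ℕ} (L : Eu n → Eu n → ℝ) (a b : ℝ) (x y : Eu n) : EReal :=
  ⨅ γ ∈ {γ : CPath a b n | IsACC γ ∧ pev γ a = x ∧ pev γ b = y}, action L a b γ

/-- The restriction of a continuous curve `ℝ → ℝⁿ` to `[a,b]` as an element of the path
space. -/
def toPath {n : ℕ} (a b : ℝ) (f : ℝ → Eu n) (hf : Continuous f) : CPath a b n :=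
  (ContinuousMap.mk f hf).restrict (Set.Icc a b)

/-- `Φ : ℝⁿ × ℝⁿ → C([a,b];ℝⁿ)` is the Euler–Lagrange (Newton) flow map for the Lagrangian
`L(x,v) = (m/2)|v|² − V(x)`: it is continuous and `Φ(x,v)` is a `C²` solution of
`m γ'' = −∇V(γ)` with initial position `x` and initial velocity `v`. -/
def IsNewtonFlow {n : ℕ} (m : ℝ) (V : Eu n → ℝ) (a b : ℝ)
    (Φ : Eu n × Eu n → CPath a b n) : Prop :=
  Continuous Φ ∧ ∀ x v : Eu n, ∃ f : ℝ → Eu n, ContDiff ℝ 2 f ∧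
    (∀ t : Set.Icc a b, Φ (x, v) t = f t) ∧ f a = x ∧ deriv f a = v ∧
    ∀ t ∈ Set.Icc a b, m • deriv (deriv f) t = -gradient V (f t)

/-- The set of `C²` solutions of `m γ'' = −∇V(γ)` starting in `Ka` and ending in `Kb`,
viewed as a subset of the path space. -/
def NewtonSet {n : ℕ} (m : ℝ) (V : Eu n → ℝ) (a b : ℝ) (Ka Kb : Set (Eu n)) :
    Set (CPath a b n) :=
  {γ | ∃ f : ℝ → Eu n, ContDiff ℝ 2 f ∧ (∀ t : Set.Icc a b, γ t = f t) ∧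
    (∀ t ∈ Set.Icc a b, m • deriv (deriv f) t = -gradient V (f t)) ∧
    f a ∈ Ka ∧ f b ∈ Kb}

/-- `γ` is piecewise affine subordinate to the partition `a = τ₀ < … < τ_l = b`. -/
def PiecewiseAffine {n : ℕ} (a b : ℝ) (τ : ℕ → ℝ) (l : ℕ) (γ : CPath a b n) : Prop :=
  ∀ j < l, ∀ t : Set.Icc a b, (t : ℝ) ∈ Set.Icc (τ j) (τ (j + 1)) →
    γ t = pev γ (τ j) + (((t : ℝ) - τ j) / (τ (j + 1) - τ j)) •
      (pev γ (τ (j + 1)) - pev γ (τ j))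

/-- `IsPartition a b τ l h`: `a = τ₀ < τ₁ < … < τ_l = b` is a partition of `[a,b]` of mesh
at most `h`. -/
def IsPartition (a b : ℝ) (τ : ℕ → ℝ) (l : ℕ) (h : ℝ) : Prop :=
  1 ≤ l ∧ τ 0 = a ∧ τ l = b ∧ (∀ j < l, τ j < τ (j + 1)) ∧
    ∀ j < l, τ (j + 1) - τ j ≤ h

/-- The midpoint-rule discrete action, as a (real-valued) sum over the first `l` intervals
of the partition. -/
def dActionSum {n : ℕ} (m : ℝ) (V : Eu n → ℝ) {a b : ℝ} (τ : ℕ → ℝ) (l : ℕ)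
    (γ : CPath a b n) : ℝ :=
  ∑ j ∈ Finset.range l,
    (m / 2 * ‖pev γ (τ (j + 1)) - pev γ (τ j)‖ ^ 2 / (τ (j + 1) - τ j) -
      V ((2 : ℝ)⁻¹ • (pev γ (τ (j + 1)) + pev γ (τ j))) * (τ (j + 1) - τ j))

open Classical in
/-- The discrete action `𝒜^{[h]}`: the midpoint-rule discrete action for piecewise affine
curves subordinate to the partition, `+∞` otherwise. -/
def dAction {n : ℕ} (m : ℝ) (V : Eu n → ℝ) (a b : ℝ) (τ : ℕ → ℝ) (l : ℕ)
    (γ : CPath a b n) : EReal :=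
  if PiecewiseAffine a b τ l γ then ((dActionSum m V τ l γ : ℝ) : EReal) else ⊤

/-- The discrete Euler–Lagrange equations for a piecewise affine curve subordinate to the
partition `a = τ₀ < … < τ_l = b`. -/
def DiscreteEL {n : ℕ} (m : ℝ) (V : Eu n → ℝ) {a b : ℝ} (τ : ℕ → ℝ) (l : ℕ)
    (γ : CPath a b n) : Prop :=
  ∀ j, 1 ≤ j → j < l →
    m • ((τ j - τ (j - 1))⁻¹ • (pev γ (τ j) - pev γ (τ (j - 1)))) -
      m • ((τ (j + 1) - τ j)⁻¹ • (pev γ (τ (j + 1)) - pev γ (τ j))) =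
    ((τ j - τ (j - 1)) / 2) • gradient V ((2 : ℝ)⁻¹ • (pev γ (τ (j - 1)) + pev γ (τ j))) +
      ((τ (j + 1) - τ j) / 2) • gradient V ((2 : ℝ)⁻¹ • (pev γ (τ j) + pev γ (τ (j + 1))))

end

/-- A bounded family in a Hilbert space converges weakly along every ultrafilter. -/
theorem Ultrafilter.exists_tendsto_inner {ι H : Type*} [NormedAddCommGroup H]
    [InnerProductSpace ℝ H] [CompleteSpace H] (U : Ultrafilter ι) (V : ι → H) (B : ℝ)
    (hV : ∀ᶠ k in (U : Filter ι), ‖V k‖ ≤ B) :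
    ∃ g : H, ∀ φ : H, Tendsto (fun k => inner ℝ φ (V k)) U (𝓝 (inner ℝ φ g)) := by
  let T : ι → WeakDual ℝ H :=
    fun k => StrongDual.toWeakDual (InnerProductSpace.toDual ℝ H (V k))
  have hmem : ((U.map T : Ultrafilter (WeakDual ℝ H)) : Filter (WeakDual ℝ H)) ≤
      𝓟 (WeakDual.toStrongDual ⁻¹' Metric.closedBall (0 : StrongDual ℝ H) B) := by
    rw [le_principal_iff]
    change ∀ᶠ k in (U : Filter ι), T k ∈ _
    filter_upwards [hV] with k hk
    change InnerProductSpace.toDual ℝ H (V k) ∈ Metric.closedBall (0 : StrongDual ℝ H) B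
    rw [mem_closedBall_zero_iff, LinearIsometryEquiv.norm_map]
    exact hk
  obtain ⟨Λ, -, hΛ⟩ := (WeakDual.isCompact_closedBall (𝕜 := ℝ) (0 : StrongDual ℝ H)
    B).ultrafilter_le_nhds _ hmem
  have hT : Tendsto T U (𝓝 Λ) := hΛ
  refine ⟨(InnerProductSpace.toDual ℝ H).symm (WeakDual.toStrongDual Λ), fun φ => ?_⟩
  have h1 := ((WeakDual.eval_continuous φ).tendsto Λ).comp hT
  have h2 : inner ℝ φ ((InnerProductSpace.toDual ℝ H).symm (WeakDual.toStrongDual Λ)) = Λ φ := by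
    rw [real_inner_comm, InnerProductSpace.toDual_symm_apply]; rfl
  rw [h2]
  refine h1.congr fun k => ?_
  change InnerProductSpace.toDual ℝ H (V k) φ = _
  rw [InnerProductSpace.toDual_apply_apply, real_inner_comm]

/-- A `C²` function whose Hessian is bounded below by `c₀` lies above its tangent planes with a
quadratic gap. -/
theorem ContDiff.tangent_add_sq_le {E : Type*} [NormedAddCommGroup E] [NormedSpace ℝ E]
    {f : E → ℝ} (hf : ContDiff ℝ 2 f) {c₀ : ℝ}
    (hc : ∀ v w : E, c₀ * ‖w‖ ^ 2 ≤ fderiv ℝ (fderiv ℝ f) v w w) (p w : E) :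
    f p + fderiv ℝ f p w + c₀ / 2 * ‖w‖ ^ 2 ≤ f (p + w) := by
  have hline : ∀ t : ℝ, HasDerivAt (fun t : ℝ => p + t • w) w t := fun t => by
    simpa using ((hasDerivAt_id t).smul_const w).const_add p
  have hf1 : Differentiable ℝ f := hf.differentiable (by norm_num)
  have hf2 : Differentiable ℝ (fderiv ℝ f) :=
    (hf.fderiv_right (m := 1) (by norm_num)).differentiable (by norm_num)
  let ψ' : ℝ → ℝ := fun t => fderiv ℝ f (p + t • w) w - fderiv ℝ f p w - c₀ * t * ‖w‖ ^ 2
  have hψ : ∀ t, HasDerivAt (fun t => f (p + t • w) - f p - t * fderiv ℝ f p w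
      - c₀ / 2 * t ^ 2 * ‖w‖ ^ 2) (ψ' t) t := fun t => by
    have h1 := (hf1 (p + t • w)).hasFDerivAt.comp_hasDerivAt t (hline t)
    have h2 := ((h1.sub_const (f p)).sub ((hasDerivAt_id t).mul_const (fderiv ℝ f p w))).sub
      ((((hasDerivAt_id t).pow 2).const_mul (c₀ / 2)).mul_const (‖w‖ ^ 2))
    refine h2.congr_deriv ?_
    simp only [ψ', id]
    push_cast
    ring
  have hψ' : ∀ t, HasDerivAt ψ'
      (fderiv ℝ (fderiv ℝ f) (p + t • w) w w - c₀ * ‖w‖ ^ 2) t := fun t => by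
    have h1 := (hf2 (p + t • w)).hasFDerivAt.comp_hasDerivAt t (hline t)
    have h1' := h1.clm_apply (hasDerivAt_const t w)
    have h2 := (h1'.sub_const (fderiv ℝ f p w)).sub
      (((hasDerivAt_id t).const_mul c₀).mul_const (‖w‖ ^ 2))
    refine h2.congr_deriv ?_
    simp
  have hmono : Monotone ψ' := monotone_of_hasDerivAt_nonneg hψ' fun t => by
    simpa using hc (p + t • w) w
  have hpos : ∀ t, 0 ≤ t → 0 ≤ ψ' t := fun t ht => by
    simpa [ψ'] using hmono ht
  have h01 := monotoneOn_of_deriv_nonneg (convex_Ici (0 : ℝ))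
    (fun t _ => (hψ t).continuousAt.continuousWithinAt)
    (fun t _ => (hψ t).differentiableAt.differentiableWithinAt)
    (fun t ht => by
      rw [(hψ t).deriv]
      exact hpos t (interior_subset ht))
    (Set.self_mem_Ici) (Set.mem_Ici.2 zero_le_one) zero_le_one
  simp at h01
  linarith

theorem integrable_norm_sq_Lp {α E : Type*} [MeasurableSpace α] {μ : Measure α}
    [NormedAddCommGroup E] (v : Lp E 2 μ) : Integrable (fun t => ‖v t‖ ^ 2) μ :=
  (memLp_two_iff_integrable_sq_norm (Lp.memLp v).1).1 (Lp.memLp v)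

theorem integral_norm_sq_Lp {α E : Type*} [MeasurableSpace α] {μ : Measure α}
    [NormedAddCommGroup E] [InnerProductSpace ℝ E] (v : Lp E 2 μ) :
    ∫ t, ‖v t‖ ^ 2 ∂μ = ‖v‖ ^ 2 := by
  rw [← real_inner_self_eq_norm_sq, L2.inner_def]
  simp only [real_inner_self_eq_norm_sq]

/-- If `xk → x` uniformly, `V k ⇀ g` weakly in `L²` and the integrals of `L (xk k) (V k)` are at
most `c`, then so is the integral of the linearization of `L (x t)` at any bounded field `p`. -/
theorem integral_tangent_le_of_tendsto_inner
    {α ι E : Type*} [MeasurableSpace α] {μ : Measure α} [IsFiniteMeasure μ]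
    [NormedAddCommGroup E] [InnerProductSpace ℝ E] [FiniteDimensional ℝ E]
    [MeasurableSpace E] [BorelSpace E] {l : Filter ι} [l.NeBot]
    {L : E → E → ℝ} {W : E → E → E}
    (hL : Continuous (Function.uncurry L)) (hW : Continuous (Function.uncurry W))
    (htan : ∀ x p v, L x p + inner ℝ (W x p) (v - p) ≤ L x v)
    {xk : ι → α → E} {x : α → E} {r : ℝ}
    (hx : Measurable x) (hxr : ∀ t, ‖x t‖ ≤ r)
    (hxkr : ∀ᶠ k in l, ∀ t, ‖xk k t‖ ≤ r)
    (hlim : ∀ ε > 0, ∀ᶠ k in l, ∀ t, ‖xk k t - x t‖ ≤ ε)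
    {V : ι → Lp E 2 μ} {B : ℝ} (hV : ∀ᶠ k in l, ‖V k‖ ≤ B) {g : Lp E 2 μ}
    (hg : ∀ φ : Lp E 2 μ, Tendsto (fun k => inner ℝ φ (V k)) l (𝓝 (inner ℝ φ g)))
    {c : ℝ} (hint : ∀ᶠ k in l, Integrable (fun t => L (xk k t) (V k t)) μ)
    (hle : ∀ᶠ k in l, ∫ t, L (xk k t) (V k t) ∂μ ≤ c)
    {p : α → E} (hp : Measurable p) {R : ℝ} (hpR : ∀ t, ‖p t‖ ≤ R) :
    Integrable (fun t => L (x t) (p t) + inner ℝ (W (x t) (p t)) (g t - p t)) μ ∧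
      ∫ t, L (x t) (p t) + inner ℝ (W (x t) (p t)) (g t - p t) ∂μ ≤ c := by
  have hcpt : IsCompact (Metric.closedBall (0 : E) r ×ˢ Metric.closedBall (0 : E) R) :=
    (isCompact_closedBall _ _).prod (isCompact_closedBall _ _)
  have hxp : Measurable fun t => (x t, p t) := hx.prodMk hp
  have hmem : ∀ t, (x t, p t) ∈ Metric.closedBall (0 : E) r ×ˢ Metric.closedBall (0 : E) R :=
    fun t => ⟨by simpa using hxr t, by simpa using hpR t⟩
  obtain ⟨A, hA⟩ := hcpt.exists_bound_of_continuousOn hL.continuousOn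
  obtain ⟨A', hA'⟩ := hcpt.exists_bound_of_continuousOn hW.continuousOn
  have hLint : Integrable (fun t => L (x t) (p t)) μ :=
    Integrable.of_bound (hL.measurable.comp hxp).aestronglyMeasurable A
      (ae_of_all _ fun t => hA _ (hmem t))
  have hwmeas : Measurable fun t => W (x t) (p t) := hW.measurable.comp hxp
  have hw : MemLp (fun t => W (x t) (p t)) 2 μ :=
    MemLp.of_bound hwmeas.aestronglyMeasurable A' (ae_of_all _ fun t => hA' _ (hmem t))
  have hpm : MemLp p 2 μ :=
    MemLp.of_bound hp.aestronglyMeasurable R (ae_of_all _ hpR)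
  have hin : ∀ v : Lp E 2 μ, Integrable (fun t => inner ℝ (W (x t) (p t)) (v t)) μ ∧
      ∫ t, inner ℝ (W (x t) (p t)) (v t) ∂μ = inner ℝ (hw.toLp _) v := fun v => by
    have hae : (fun t => inner ℝ (hw.toLp _ t) (v t)) =ᵐ[μ]
        fun t => inner ℝ (W (x t) (p t)) (v t) := by
      filter_upwards [hw.coeFn_toLp] with t ht
      rw [ht]
    exact ⟨(L2.integrable_inner _ _).congr hae, by rw [L2.inner_def, integral_congr_ae hae]⟩
  have hpint : Integrable (fun t => inner ℝ (W (x t) (p t)) (p t)) μ := by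
    refine (hin (hpm.toLp p)).1.congr ?_
    filter_upwards [hpm.coeFn_toLp] with t ht
    rw [ht]
  have hsplit : ∀ v : Lp E 2 μ,
      Integrable (fun t => L (x t) (p t) + inner ℝ (W (x t) (p t)) (v t - p t)) μ ∧
      ∫ t, L (x t) (p t) + inner ℝ (W (x t) (p t)) (v t - p t) ∂μ =
        ∫ t, L (x t) (p t) ∂μ + (inner ℝ (hw.toLp _) v
          - ∫ t, inner ℝ (W (x t) (p t)) (p t) ∂μ) := fun v => by
    simp_rw [inner_sub_right]
    have hsub := (hin v).1.sub' hpint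
    exact ⟨hLint.add hsub, by
      rw [integral_add hLint hsub, integral_sub (hin v).1 hpint, (hin v).2]⟩
  refine ⟨(hsplit g).1, ?_⟩
  have hunif := Metric.uniformContinuousOn_iff_le.1
    (hcpt.uniformContinuousOn_of_continuous (hL.prodMk hW).continuousOn)
  set C : ℝ := μ.real Set.univ * (2 + R) + B ^ 2 with hC
  have key : ∀ ε > 0, ∫ t, L (x t) (p t) + inner ℝ (W (x t) (p t)) (g t - p t) ∂μ
      ≤ c + ε * C := by
    intro ε hε
    obtain ⟨δ, hδ, hδ'⟩ := hunif ε hε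
    rw [(hsplit g).2]
    have ht : Tendsto (fun k => ∫ t, L (x t) (p t) ∂μ + (inner ℝ (hw.toLp _) (V k)
          - ∫ t, inner ℝ (W (x t) (p t)) (p t) ∂μ)) l (𝓝 (∫ t, L (x t) (p t) ∂μ +
          (inner ℝ (hw.toLp _) g - ∫ t, inner ℝ (W (x t) (p t)) (p t) ∂μ))) :=
      ((hg _).sub_const _).const_add _
    refine le_of_tendsto ht ?_
    filter_upwards [hxkr, hlim δ hδ, hV, hint, hle] with k hkr hkδ hkB hki hkc
    rw [← (hsplit (V k)).2]
    have hB : ‖V k‖ ^ 2 ≤ B ^ 2 := by gcongr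
    have hcI : Integrable (fun t => ε * (2 + R + ‖V k t‖ ^ 2)) μ :=
      ((integrable_const _).add (integrable_norm_sq_Lp (V k))).const_mul ε
    calc ∫ t, L (x t) (p t) + inner ℝ (W (x t) (p t)) (V k t - p t) ∂μ
        ≤ ∫ t, L (xk k t) (V k t) + ε * (2 + R + ‖V k t‖ ^ 2) ∂μ := by
          refine integral_mono (hsplit (V k)).1 (hki.add hcI) fun t => ?_
          have hm : (xk k t, p t) ∈ Metric.closedBall (0 : E) r ×ˢ Metric.closedBall (0 : E) R :=
            ⟨by simpa using hkr t, by simpa using hpR t⟩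
          have hd := hδ' _ hm _ (hmem t) (by
            rw [Prod.dist_eq, dist_self, max_eq_left dist_nonneg, dist_eq_norm]
            exact hkδ t)
          rw [Prod.dist_eq, max_le_iff] at hd
          obtain ⟨hd1, hd2⟩ := hd
          simp only [Function.uncurry] at hd1 hd2
          rw [Real.dist_eq, abs_le] at hd1
          rw [dist_eq_norm] at hd2
          have h1 := htan (xk k t) (p t) (V k t)
          have h2 := (abs_le.1 (abs_real_inner_le_norm
            (W (xk k t) (p t) - W (x t) (p t)) (V k t - p t))).1
          rw [inner_sub_left] at h2
          have h3 : ‖W (xk k t) (p t) - W (x t) (p t)‖ * ‖V k t - p t‖ ≤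
              ε * (1 + R + ‖V k t‖ ^ 2) := by
            have h4 : ‖V k t - p t‖ ≤ 1 + R + ‖V k t‖ ^ 2 := by
              have := norm_sub_le (V k t) (p t)
              nlinarith [hpR t, sq_nonneg (‖V k t‖ - 1), norm_nonneg (V k t)]
            gcongr
          simp only
          linarith
      _ = ∫ t, L (xk k t) (V k t) ∂μ + ε * (μ.real Set.univ * (2 + R) + ‖V k‖ ^ 2) := by
          rw [integral_add hki hcI, integral_const_mul, integral_add (integrable_const _)
            (integrable_norm_sq_Lp (V k)), integral_norm_sq_Lp (V k), integral_const, smul_eq_mul]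
      _ ≤ c + ε * C := by
          rw [hC]
          gcongr
  refine le_of_forall_pos_le_add fun η hη => ?_
  have h := key (η / (|C| + 1)) (by positivity)
  refine h.trans ?_
  have : η / (|C| + 1) * C ≤ η := by
    rw [div_mul_eq_mul_div, div_le_iff₀ (by positivity)]
    nlinarith [le_abs_self C]
  linarith

/-- If the integrals of all linearizations of `L (x t)` at bounded fields, evaluated at `g`, are at
most `c`, then so is the integral of `L (x t) (g t)`. -/
theorem integral_le_of_integral_tangent_le
    {α E : Type*} [MeasurableSpace α] {μ : Measure α} [IsFiniteMeasure μ]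
    [NormedAddCommGroup E] [InnerProductSpace ℝ E] [FiniteDimensional ℝ E]
    [MeasurableSpace E] [BorelSpace E]
    {L : E → E → ℝ} {W : E → E → E}
    (hL : Continuous (Function.uncurry L)) (hW : Continuous (Function.uncurry W))
    {c₂ : ℝ} (hbelow : ∀ x v, -c₂ ≤ L x v)
    {x g : α → E} {r c : ℝ} (hx : Measurable x) (hxr : ∀ t, ‖x t‖ ≤ r)
    (hgm : Measurable g) (hgi : Integrable g μ)
    (H : ∀ (p : α → E) (R : ℝ), Measurable p → (∀ t, ‖p t‖ ≤ R) →
      Integrable (fun t => L (x t) (p t) + inner ℝ (W (x t) (p t)) (g t - p t)) μ ∧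
      ∫ t, L (x t) (p t) + inner ℝ (W (x t) (p t)) (g t - p t) ∂μ ≤ c) :
    Integrable (fun t => L (x t) (g t)) μ ∧ ∫ t, L (x t) (g t) ∂μ ≤ c := by
  have hcpt := isCompact_closedBall (0 : E) r
  obtain ⟨A, hA⟩ := hcpt.exists_bound_of_continuousOn
    (f := fun y => L y 0) (hL.comp (continuous_id.prodMk continuous_const)).continuousOn
  obtain ⟨A', hA'⟩ := hcpt.exists_bound_of_continuousOn
    (f := fun y => W y 0) (hW.comp (continuous_id.prodMk continuous_const)).continuousOn
  set M := |A| + |A'| + |c₂| with hM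
  let p : ℕ → α → E := fun N => {t | ‖g t‖ ≤ N}.indicator g
  have hpm : ∀ N, Measurable (p N) := fun N =>
    hgm.indicator (measurableSet_le hgm.norm measurable_const)
  have hpN : ∀ N t, ‖p N t‖ ≤ N := fun N t => by
    by_cases ht : ‖g t‖ ≤ N
    · simp [p, ht]
    · simp [p, ht]
  have hm : Integrable (fun t => M * (1 + ‖g t‖)) μ :=
    ((integrable_const _).add hgi.norm).const_mul M
  let q : ℕ → α → ℝ := fun N t =>
    L (x t) (p N t) + inner ℝ (W (x t) (p N t)) (g t - p N t) + M * (1 + ‖g t‖)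
  have hqi : ∀ N, Integrable (q N) μ := fun N => (H _ _ (hpm N) (hpN N)).1.add hm
  have hq : ∀ N, ∫ t, q N t ∂μ ≤ c + ∫ t, M * (1 + ‖g t‖) ∂μ := fun N => by
    rw [integral_add (H _ _ (hpm N) (hpN N)).1 hm]
    gcongr
    exact (H _ _ (hpm N) (hpN N)).2
  have hh0 : ∀ t, 0 ≤ L (x t) (g t) + M * (1 + ‖g t‖) := fun t => by
    have h1 := hbelow (x t) (g t)
    have h2 : 0 ≤ M := by positivity
    have h3 : c₂ ≤ M := by rw [hM]; linarith [le_abs_self c₂, abs_nonneg A, abs_nonneg A']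
    nlinarith [norm_nonneg (g t)]
  have hq0 : ∀ N t, 0 ≤ q N t := fun N t => by
    by_cases ht : ‖g t‖ ≤ N
    · simpa [q, p, ht] using hh0 t
    · have h1 := hA (x t) (by simpa using hxr t)
      have h2 := hA' (x t) (by simpa using hxr t)
      have h3 := (abs_le.1 (abs_real_inner_le_norm (W (x t) 0) (g t))).1
      rw [Real.norm_eq_abs, abs_le] at h1
      have h4 : ‖W (x t) 0‖ * ‖g t‖ ≤ |A'| * ‖g t‖ := by
        gcongr
        exact h2.trans (le_abs_self _)
      simp only [q, p, Set.indicator, Set.mem_ofPred_eq, ht, if_false, sub_zero, hM]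
      nlinarith [le_abs_self A, abs_nonneg A, abs_nonneg A', abs_nonneg c₂, norm_nonneg (g t),
        mul_nonneg (abs_nonneg A) (norm_nonneg (g t)),
        mul_nonneg (abs_nonneg c₂) (norm_nonneg (g t))]
  have hlim : ∀ t, liminf (fun N => ENNReal.ofReal (q N t)) atTop =
      ENNReal.ofReal (L (x t) (g t) + M * (1 + ‖g t‖)) := fun t => by
    refine Tendsto.liminf_eq (tendsto_const_nhds.congr' ?_)
    obtain ⟨N₀, hN₀⟩ := exists_nat_ge ‖g t‖
    filter_upwards [eventually_ge_atTop N₀] with N hN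
    have ht : ‖g t‖ ≤ N := hN₀.trans (by exact_mod_cast hN)
    simp [q, p, ht]
  have hfatou : ∫⁻ t, ENNReal.ofReal (L (x t) (g t) + M * (1 + ‖g t‖)) ∂μ ≤
      ENNReal.ofReal (c + ∫ t, M * (1 + ‖g t‖) ∂μ) := by
    simp_rw [← hlim]
    refine (lintegral_liminf_le' fun N =>
      (hqi N).aestronglyMeasurable.aemeasurable.ennreal_ofReal).trans ?_
    refine liminf_le_of_le (by isBoundedDefault) fun y hy => ?_
    obtain ⟨N, hN⟩ := hy.exists
    refine hN.trans ?_
    rw [← ofReal_integral_eq_lintegral_ofReal (hqi N) (ae_of_all _ (hq0 N))]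
    exact ENNReal.ofReal_le_ofReal (hq N)
  have hmeas : Measurable fun t => L (x t) (g t) + M * (1 + ‖g t‖) :=
    (hL.measurable.comp (hx.prodMk hgm)).add ((hgm.norm.const_add 1).const_mul M)
  have hi : Integrable (fun t => L (x t) (g t) + M * (1 + ‖g t‖)) μ :=
    (lintegral_ofReal_ne_top_iff_integrable hmeas.aestronglyMeasurable
      (ae_of_all _ hh0)).1 (ne_top_of_le_ne_top ENNReal.ofReal_ne_top hfatou)
  have hLi : Integrable (fun t => L (x t) (g t)) μ := by
    simpa using hi.sub' hm
  refine ⟨hLi, ?_⟩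
  have hc : 0 ≤ c + ∫ t, M * (1 + ‖g t‖) ∂μ :=
    (integral_nonneg (hq0 0)).trans (hq 0)
  rw [← ofReal_integral_eq_lintegral_ofReal hi (ae_of_all _ hh0),
    ENNReal.ofReal_le_ofReal_iff hc, integral_add hLi hm] at hfatou
  linarith

/-- An interval integrand is determined almost everywhere by its integrals over subintervals. -/
theorem ae_eq_of_forall_intervalIntegral_eq {E : Type*} [NormedAddCommGroup E] [NormedSpace ℝ E]
    [CompleteSpace E] {a b : ℝ} (hab : a ≤ b) {f g : ℝ → E} (hf : IntegrableOn f (Set.Icc a b))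
    (hg : IntegrableOn g (Set.Icc a b))
    (h : ∀ t ∈ Set.Icc a b, ∫ u in a..t, f u = ∫ u in a..t, g u) :
    f =ᵐ[volume.restrict (Set.Icc a b)] g := by
  have hf' : IntervalIntegrable f volume a b :=
    (intervalIntegrable_iff_integrableOn_Icc_of_le hab).2 hf
  have hg' : IntervalIntegrable g volume a b :=
    (intervalIntegrable_iff_integrableOn_Icc_of_le hab).2 hg
  rw [← restrict_Ioo_eq_restrict_Icc]
  filter_upwards [ae_restrict_mem measurableSet_Ioo,
    ae_restrict_of_ae hf'.ae_hasDerivAt_integral,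
    ae_restrict_of_ae hg'.ae_hasDerivAt_integral] with t ht h1 h2
  rw [Set.uIcc_of_le hab] at h1 h2
  have ha : a ∈ Set.Icc a b := Set.left_mem_Icc.2 hab
  have ht' := Set.Ioo_subset_Icc_self ht
  refine (h1 ht' a ha).unique ((h2 ht' a ha).congr_of_eventuallyEq ?_)
  filter_upwards [Icc_mem_nhds ht.1 ht.2] with s hs using h s hs

section Path

variable {a b : ℝ} {n : ℕ}

theorem pev_of_mem (γ : CPath a b n) {t : ℝ} (ht : t ∈ Set.Icc a b) : pev γ t = γ ⟨t, ht⟩ :=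
  dif_pos ht

theorem norm_pev_sub_le (γ γ' : CPath a b n) (t : ℝ) : ‖pev γ t - pev γ' t‖ ≤ dist γ γ' := by
  by_cases ht : t ∈ Set.Icc a b
  · rw [pev_of_mem γ ht, pev_of_mem γ' ht, ← dist_eq_norm]
    exact ContinuousMap.dist_apply_le_dist _
  · simp [pev, ht]

theorem norm_pev_le (γ : CPath a b n) (t : ℝ) : ‖pev γ t‖ ≤ ‖γ‖ := by
  have h := norm_pev_sub_le γ 0 t
  have h0 : pev (0 : CPath a b n) t = 0 := by simp [pev]
  rwa [h0, sub_zero, dist_zero_right] at h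

theorem measurable_pev (γ : CPath a b n) : Measurable (pev γ) := by
  rcases le_or_gt a b with hab | hab
  · have h : pev γ = (Set.Icc a b).indicator (Set.IccExtend hab γ) := by
      funext t
      by_cases ht : t ∈ Set.Icc a b
      · rw [pev_of_mem γ ht, Set.indicator_of_mem ht, Set.IccExtend_of_mem hab _ ht]
      · simp [pev, ht]
    rw [h]
    exact γ.continuous.Icc_extend'.measurable.indicator measurableSet_Icc
  · have h : pev γ = fun _ => 0 := by
      funext t
      simp [pev, hab.not_ge]
    rw [h]
    exact measurable_const

/-- A curve with finite action has an `L²` derivative, provided the Lagrangian grows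
quadratically near the curve. -/
theorem exists_Lp_deriv_of_action_lt {L : Eu n → Eu n → ℝ} {r κ M c : ℝ} (hab : a ≤ b)
    (hκ : 0 < κ) (hq : ∀ x v, ‖x‖ ≤ r → κ * ‖v‖ ^ 2 - M ≤ L x v)
    {γ : CPath a b n} (hγ : ‖γ‖ ≤ r) (hc : action L a b γ < (c : EReal)) :
    ∃ v : Lp (Eu n) 2 (volume.restrict (Set.Icc a b)),
      ‖v‖ ≤ √((c + (b - a) * M) / κ) ∧
      Integrable (fun t => L (pev γ t) (v t)) (volume.restrict (Set.Icc a b)) ∧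
      ∫ t in Set.Icc a b, L (pev γ t) (v t) ≤ c ∧
      ∀ s t : Set.Icc a b, γ t = γ s + ∫ u in (s : ℝ)..(t : ℝ), v u := by
  unfold action at hc
  split_ifs at hc with hA hI
  · obtain ⟨hgi, hgd⟩ := hA.choose_spec
    set g := hA.choose
    rw [EReal.coe_lt_coe_iff] at hc
    have hbd : ∀ t, ‖g t‖ ^ 2 ≤ κ⁻¹ * (L (pev γ t) (g t) + M) := fun t => by
      rw [inv_mul_eq_div, le_div_iff₀ hκ]
      linarith [hq (pev γ t) (g t) ((norm_pev_le γ t).trans hγ)]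
    have hmaj : Integrable (fun t => κ⁻¹ * (L (pev γ t) (g t) + M))
        (volume.restrict (Set.Icc a b)) :=
      (Integrable.add hI (integrable_const M)).const_mul _
    have hsq : Integrable (fun t => ‖g t‖ ^ 2) (volume.restrict (Set.Icc a b)) :=
      hmaj.mono' (hgi.aestronglyMeasurable.norm.pow 2)
        (ae_of_all _ fun t => by simpa using hbd t)
    have hg2 : MemLp g 2 (volume.restrict (Set.Icc a b)) :=
      (memLp_two_iff_integrable_sq_norm hgi.aestronglyMeasurable).2 hsq
    have hae := hg2.coeFn_toLp
    have haeL : (fun t => L (pev γ t) (g t)) =ᵐ[volume.restrict (Set.Icc a b)]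
        fun t => L (pev γ t) (hg2.toLp g t) := by
      filter_upwards [hae] with t ht
      rw [ht]
    refine ⟨hg2.toLp g, Real.le_sqrt_of_sq_le ?_, Integrable.congr hI haeL, ?_, fun s t => ?_⟩
    · rw [← integral_norm_sq_Lp, integral_congr_ae (g := fun t => ‖g t‖ ^ 2)
        (by filter_upwards [hae] with t ht; rw [ht])]
      refine (integral_mono hsq hmaj hbd).trans ?_
      rw [integral_const_mul, integral_add hI (integrable_const M), integral_const,
        inv_mul_eq_div]
      gcongr
      simp [hab]
    · rw [← integral_congr_ae haeL]
      exact hc.le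
    · rw [hgd s t]
      congr 1
      refine intervalIntegral.integral_congr_ae ?_
      filter_upwards [(ae_restrict_iff' measurableSet_Icc).1 hae] with u hu hust
      exact (hu ((Set.uIcc_subset_Icc s.2 t.2) (Set.uIoc_subset_uIcc hust))).symm
  · exact absurd hc not_top_lt
  · exact absurd hc not_top_lt

/-- Weak `L²` limits of derivatives are derivatives of the pointwise limit. -/
theorem eq_add_integral_of_tendsto_inner {ι : Type*} {l : Filter ι} [l.NeBot]
    {γk : ι → CPath a b n} {γ : CPath a b n} (hγ : Tendsto γk l (𝓝 γ))
    {V : ι → Lp (Eu n) 2 (volume.restrict (Set.Icc a b))}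
    {g : Lp (Eu n) 2 (volume.restrict (Set.Icc a b))}
    (hV : ∀ᶠ k in l, ∀ s t : Set.Icc a b, γk k t = γk k s + ∫ u in (s : ℝ)..(t : ℝ), V k u)
    (hg : ∀ φ, Tendsto (fun k => inner ℝ φ (V k)) l (𝓝 (inner ℝ φ g))) (s t : Set.Icc a b) :
    γ t = γ s + ∫ u in (s : ℝ)..(t : ℝ), g u := by
  wlog hst : s ≤ t generalizing s t
  · have h := this t s (le_of_not_ge hst)
    rw [intervalIntegral.integral_symm, h]
    abel
  have hst' : (s : ℝ) ≤ t := hst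
  rw [← sub_eq_iff_eq_add']
  have hres : (volume.restrict (Set.Icc a b)).restrict (Set.Ioc (s : ℝ) t) =
      volume.restrict (Set.Ioc (s : ℝ) t) := by
    rw [Measure.restrict_restrict measurableSet_Ioc, Set.inter_eq_left.2]
    exact fun u hu => ⟨s.2.1.trans hu.1.le, hu.2.trans t.2.2⟩
  refine ext_inner_left ℝ fun y => ?_
  have hpt : ∀ u : Set.Icc a b, Tendsto (fun k => γk k u) l (𝓝 (γ u)) := fun u =>
    ((continuous_eval_const u).tendsto γ).comp hγ
  have h1 : Tendsto (fun k => inner ℝ y (γk k t - γk k s)) l (𝓝 (inner ℝ y (γ t - γ s))) :=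
    tendsto_const_nhds.inner ((hpt t).sub (hpt s))
  have h2 := hg (indicatorConstLp 2 (measurableSet_Ioc (a := (s : ℝ)) (b := t))
    (measure_ne_top _ _) y)
  simp only [L2.inner_indicatorConstLp_eq_inner_setIntegral, hres] at h2
  rw [intervalIntegral.integral_of_le hst']
  refine tendsto_nhds_unique_of_eventuallyEq h1 h2 ?_
  filter_upwards [hV] with k hk
  rw [hk s t, add_sub_cancel_left, intervalIntegral.integral_of_le hst']

/-- The action may be computed with any integrable derivative. -/
theorem action_le_of_integral_le {L : Eu n → Eu n → ℝ} {γ : CPath a b n} {c : ℝ} (hab : a ≤ b)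
    {g : ℝ → Eu n} (hgi : IntegrableOn g (Set.Icc a b))
    (hgd : ∀ s t : Set.Icc a b, γ t = γ s + ∫ u in (s : ℝ)..(t : ℝ), g u)
    (hI : IntegrableOn (fun t => L (pev γ t) (g t)) (Set.Icc a b))
    (hc : ∫ t in Set.Icc a b, L (pev γ t) (g t) ≤ c) : action L a b γ ≤ c := by
  have hA : IsACC γ := ⟨g, hgi, hgd⟩
  obtain ⟨hgi', hgd'⟩ := hA.choose_spec
  have hae : hA.choose =ᵐ[volume.restrict (Set.Icc a b)] g :=
    ae_eq_of_forall_intervalIntegral_eq hab hgi' hgi fun t ht =>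
      add_left_cancel ((hgd' ⟨a, Set.left_mem_Icc.2 hab⟩ ⟨t, ht⟩).symm.trans (hgd _ _))
  have haeL : (fun t => L (pev γ t) (g t)) =ᵐ[volume.restrict (Set.Icc a b)]
      fun t => L (pev γ t) (hA.choose t) := by
    filter_upwards [hae] with t ht
    rw [ht]
  unfold action
  have hI' : IntegrableOn (fun t => L (pev γ t) (hA.choose t)) (Set.Icc a b) :=
    Integrable.congr hI haeL
  rw [dif_pos hA, if_pos hI', EReal.coe_le_coe_iff]
  exact (integral_congr_ae haeL).symm.trans_le hc

/-- Strong convexity in the velocity gives quadratic growth over bounded positions. -/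
theorem exists_quadratic_lower_bound {E : Type*} [NormedAddCommGroup E] [NormedSpace ℝ E]
    [FiniteDimensional ℝ E] {L : E → E → ℝ} (hL : ContDiff ℝ 2 (Function.uncurry L))
    (hconv : ∀ K : Set E, IsCompact K → ∃ c₀ : ℝ, 0 < c₀ ∧
      ∀ x ∈ K, ∀ v w : E, c₀ * ‖w‖ ^ 2 ≤ fderiv ℝ (fderiv ℝ (L x)) v w w) (r : ℝ) :
    ∃ κ M : ℝ, 0 < κ ∧ ∀ x v, ‖x‖ ≤ r → κ * ‖v‖ ^ 2 - M ≤ L x v := by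
  have hcpt : IsCompact (Metric.closedBall (0 : E) r) := isCompact_closedBall _ _
  obtain ⟨c₀, hc₀, hc⟩ := hconv _ hcpt
  have hcont : Continuous fun x => L x 0 :=
    hL.continuous.comp (continuous_id.prodMk continuous_const)
  have hcont' : Continuous fun x => fderiv ℝ (L x) 0 :=
    (ContDiff.fderiv (n := 1) hL contDiff_const (by norm_num) : ContDiff ℝ 1 _).continuous
  obtain ⟨A, hA⟩ := hcpt.exists_bound_of_continuousOn hcont.continuousOn
  obtain ⟨A', hA'⟩ := hcpt.exists_bound_of_continuousOn hcont'.continuousOn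
  refine ⟨c₀ / 4, A + A' ^ 2 / c₀, by positivity, fun x v hx => ?_⟩
  have hx' : x ∈ Metric.closedBall (0 : E) r := by simpa using hx
  have hLx : ContDiff ℝ 2 (L x) := hL.comp (contDiff_const.prodMk contDiff_id)
  have h1 := hLx.tangent_add_sq_le (hc x hx') 0 v
  have h2 := (abs_le.1 (hA x hx')).1
  have h3 := (abs_le.1 ((fderiv ℝ (L x) 0).le_opNorm v)).1
  have h4 : ‖fderiv ℝ (L x) 0‖ * ‖v‖ ≤ A' * ‖v‖ := by
    gcongr
    exact hA' x hx'
  have h5 : A' * ‖v‖ ≤ c₀ / 4 * ‖v‖ ^ 2 + A' ^ 2 / c₀ := by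
    have : 0 ≤ (c₀ / 2 * ‖v‖ - A') ^ 2 / c₀ := by positivity
    have e : (c₀ / 2 * ‖v‖ - A') ^ 2 / c₀ = c₀ / 4 * ‖v‖ ^ 2 + A' ^ 2 / c₀ - A' * ‖v‖ := by
      field_simp
      ring
    linarith
  rw [zero_add] at h1
  linarith

end Path

/-- **Lower semicontinuity of the action (Lemma 3.5).**
The action functional `𝒜` is sequentially lower semicontinuous on `(C([a,b];ℝⁿ), d_Γ)`:
if `γ_k → γ` uniformly, then `liminf 𝒜(γ_k) ≥ 𝒜(γ)`. -/
theorem action_lower_semicontinuous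
    {n : ℕ} (hn : 1 ≤ n) {a b : ℝ} (hab : a < b)
    (L : Eu n → Eu n → ℝ)
    (hL1 : ContDiff ℝ (⊤ : ℕ∞) (Function.uncurry L))
    (hL2 : ∀ K : Set (Eu n), IsCompact K → ∃ c₀ : ℝ, 0 < c₀ ∧
      ∀ x ∈ K, ∀ v w : Eu n, c₀ * ‖w‖ ^ 2 ≤ fderiv ℝ (fderiv ℝ (L x)) v w w)
    (c₁ c₂ : ℝ) (hc₁ : 0 < c₁) (hc₂ : 0 < c₂)
    (hL3 : ∀ x v : Eu n, c₁ * ‖v‖ - c₂ ≤ L x v)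
    (γk : ℕ → CPath a b n) (γ : CPath a b n) (hconv : Tendsto γk atTop (𝓝 γ)) :
    action L a b γ ≤ liminf (fun k => action L a b (γk k)) atTop := by
  by_contra! hlt
  obtain ⟨c, hc₁', hc₂'⟩ := exists_between hlt
  have hfreq : ∃ᶠ k in atTop, action L a b (γk k) < c :=
    frequently_lt_of_liminf_lt (by isBoundedDefault) hc₁'
  have hctop : c ≠ ⊤ := (hc₂'.trans_le le_top).ne
  have hcbot : c ≠ ⊥ := (bot_le.trans_lt hc₁').ne'
  lift c to ℝ using ⟨hctop, hcbot⟩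
  refine hc₂'.not_ge ?_
  have hne : (atTop ⊓ 𝓟 {k | action L a b (γk k) < (c : EReal)}).NeBot :=
    frequently_mem_iff_neBot.1 hfreq
  let U : Ultrafilter ℕ := Ultrafilter.of (atTop ⊓ 𝓟 {k | action L a b (γk k) < (c : EReal)})
  have hU : (U : Filter ℕ) ≤ _ := Ultrafilter.of_le _
  have hUconv : Tendsto γk U (𝓝 γ) := hconv.mono_left (hU.trans inf_le_left)
  have hUc : ∀ᶠ k in (U : Filter ℕ), action L a b (γk k) < (c : EReal) :=
    le_principal_iff.1 (hU.trans inf_le_right)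
  have hUr : ∀ᶠ k in (U : Filter ℕ), ‖γk k‖ ≤ ‖γ‖ + 1 :=
    (hUconv.norm.eventually (gt_mem_nhds (lt_add_one ‖γ‖))).mono fun _ h => le_of_lt h
  have hL1' : ContDiff ℝ 2 (Function.uncurry L) := contDiff_infty.1 hL1 2
  obtain ⟨κ, M, hκ, hq⟩ := exists_quadratic_lower_bound hL1' hL2 (‖γ‖ + 1)
  have hV : ∀ k, ‖γk k‖ ≤ ‖γ‖ + 1 ∧ action L a b (γk k) < (c : EReal) → _ := fun k hk =>
    exists_Lp_deriv_of_action_lt hab.le hκ hq hk.1 hk.2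
  choose! V hVB hVI hVc hVd using hV
  have hUV := hUr.and hUc
  obtain ⟨g, hg⟩ := U.exists_tendsto_inner V _ (hUV.mono hVB)
  have hgd := eq_add_integral_of_tendsto_inner hUconv (hUV.mono hVd) hg
  have hgi : Integrable g (volume.restrict (Set.Icc a b)) :=
    (Lp.memLp g).integrable (by norm_num)
  let W : Eu n → Eu n → Eu n := fun x p =>
    (InnerProductSpace.toDual ℝ (Eu n)).symm (fderiv ℝ (L x) p)
  have hfd : ContDiff ℝ 1 fun q : Eu n × Eu n => fderiv ℝ (L q.1) q.2 :=
    ContDiff.fderiv (n := 1) (f := fun q : Eu n × Eu n => L q.1)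
      (hL1'.comp ((contDiff_fst.comp contDiff_fst).prodMk contDiff_snd)) contDiff_snd (by norm_num)
  have hW : Continuous (Function.uncurry W) :=
    (InnerProductSpace.toDual ℝ (Eu n)).symm.continuous.comp hfd.continuous
  have htan : ∀ x p v, L x p + inner ℝ (W x p) (v - p) ≤ L x v := fun x p v => by
    obtain ⟨c₀, hc₀, hc⟩ := hL2 {x} isCompact_singleton
    have hLx : ContDiff ℝ 2 (L x) := hL1'.comp (contDiff_const.prodMk contDiff_id)
    have h := hLx.tangent_add_sq_le (hc x rfl) p (v - p)
    rw [add_sub_cancel] at h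
    rw [InnerProductSpace.toDual_symm_apply]
    have : 0 ≤ c₀ / 2 * ‖v - p‖ ^ 2 := by positivity
    linarith
  have hbelow : ∀ x v, -c₂ ≤ L x v := fun x v => by
    have : 0 ≤ c₁ * ‖v‖ := by positivity
    linarith [hL3 x v]
  have hxr : ∀ t, ‖pev γ t‖ ≤ ‖γ‖ + 1 := fun t => (norm_pev_le γ t).trans (by linarith)
  have hres := integral_le_of_integral_tangent_le hL1'.continuous hW hbelow (measurable_pev γ)
    hxr (Lp.stronglyMeasurable g).measurable hgi fun p R hp hpR =>
      integral_tangent_le_of_tendsto_inner hL1'.continuous hW htan (xk := fun k => pev (γk k))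
        (measurable_pev γ) hxr (hUr.mono fun k hk t => (norm_pev_le _ t).trans hk)
        (fun ε hε => (Metric.tendsto_nhds.1 hUconv ε hε).mono fun k hk t =>
          (norm_pev_sub_le _ _ t).trans hk.le)
        (hUV.mono hVB) hg (hUV.mono hVI) (hUV.mono hVc) hp hpR
  exact action_le_of_integral_le hab.le hgi hgd hres.1 hres.2
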